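/- Let n ≥ 1. There is no smooth positive function u : ℝⁿ → ℝ satisfying Δu = u³ on all of ℝⁿ. -/

import Mathlib

open Real Metric

/-- The Euclidean Laplacian: trace of the Hessian. -/
noncomputable def lap {n : ℕ} (f : EuclideanSpace ℝ (Fin n) → ℝ)
    (x : EuclideanSpace ℝ (Fin n)) : ℝ :=
  ∑ i : Fin n,
    fderiv ℝ (fun y => fderiv ℝ f y (EuclideanSpace.single i 1)) x
      (EuclideanSpace.single i 1)

/-- Necessary second order condition at a local maximum. -/
lemma IsLocalMax.second_deriv_nonpos {h h' : ℝ → ℝ} {a c : ℝ} (hm : IsLocalMax h a)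
    (hd : ∀ t, HasDerivAt h (h' t) t) (hc : HasDerivAt h' c a) : c ≤ 0 := by
  by_contra! hpos
  have hderiv : deriv h = h' := funext fun t => (hd t).deriv
  have hmin : IsLocalMin h a := by
    apply isLocalMin_of_deriv_deriv_pos
    · rw [hderiv, hc.deriv]
      exact hpos
    · rw [hm.deriv_eq_zero]
    · exact (hd a).continuousAt
  have hconst : h =ᶠ[nhds a] fun _ => h a := by
    filter_upwards [hm, hmin] with t h1 h2 using le_antisymm h1 h2
  have hzero : h' =ᶠ[nhds a] fun _ => 0 := by
    rw [← hderiv]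
    simpa using hconst.deriv
  have := hc.unique ((hasDerivAt_const a (0 : ℝ)).congr_of_eventuallyEq hzero)
  exact hpos.ne' this

/-- First and second order conditions, in the direction `e`, at a local maximum `z` of
`y ↦ u y * (R ^ 2 - ‖y‖ ^ 2)`. -/
lemma IsLocalMax.directional_conditions {E : Type*} [NormedAddCommGroup E]
    [InnerProductSpace ℝ E] {u : E → ℝ} (hu : ContDiff ℝ 2 u) {R : ℝ} {z : E}
    (hz : IsLocalMax (fun y => u y * (R ^ 2 - ‖y‖ ^ 2)) z) {e : E} (he : ‖e‖ = 1) :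
    fderiv ℝ u z e * (R ^ 2 - ‖z‖ ^ 2) = 2 * inner ℝ z e * u z ∧
      fderiv ℝ (fun y => fderiv ℝ u y e) z e * (R ^ 2 - ‖z‖ ^ 2)
        ≤ 4 * inner ℝ z e * fderiv ℝ u z e + 2 * u z := by
  have hline : ∀ t : ℝ, HasDerivAt (fun t : ℝ => z + t • e) e t := fun t => by
    simpa using ((hasDerivAt_id t).smul_const e).const_add z
  have hD : Differentiable ℝ (fun y => fderiv ℝ u y e) := by
    have : ContDiff ℝ 1 (fun y => fderiv ℝ u y e) :=
      (hu.fderiv_right (by norm_num)).clm_apply contDiff_const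
    exact this.differentiable (by norm_num)
  have hg : ∀ t : ℝ, HasDerivAt (fun t : ℝ => u (z + t • e)) (fderiv ℝ u (z + t • e) e) t :=
    fun t => ((hu.differentiable (by norm_num)) _).hasFDerivAt.comp_hasDerivAt t (hline t)
  have hg' : HasDerivAt (fun t : ℝ => fderiv ℝ u (z + t • e) e)
      (fderiv ℝ (fun y => fderiv ℝ u y e) z e) 0 := by
    have := (hD (z + (0 : ℝ) • e)).hasFDerivAt.comp_hasDerivAt 0 (hline 0)
    rw [zero_smul, add_zero] at this
    exact this
  have hw : ∀ t : ℝ, HasDerivAt (fun t : ℝ => R ^ 2 - ‖z + t • e‖ ^ 2)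
      (-(2 * inner ℝ z e + 2 * t)) t := fun t => by
    have h1 := ((hline t).norm_sq).const_sub (R ^ 2)
    rw [inner_add_left, real_inner_smul_left, real_inner_self_eq_norm_sq, he] at h1
    exact h1.congr_deriv (by ring)
  have hw' : HasDerivAt (fun t : ℝ => -(2 * inner ℝ z e + 2 * t)) (-2) 0 := by
    exact ((((hasDerivAt_id (0 : ℝ)).const_mul 2).const_add (2 * inner ℝ z e)).neg).congr_deriv
      (by ring)
  have hmax : IsLocalMax (fun t : ℝ => u (z + t • e) * (R ^ 2 - ‖z + t • e‖ ^ 2)) 0 := by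
    have h0 : Filter.Tendsto (fun t : ℝ => z + t • e) (nhds 0) (nhds z) := by
      simpa using (hline 0).continuousAt.tendsto
    have := h0.eventually hz
    simpa [IsLocalMax, IsMaxFilter] using this
  have hfirst := hmax.hasDerivAt_eq_zero ((hg 0).mul (hw 0))
  have hsecond := hmax.second_deriv_nonpos (fun t => (hg t).mul (hw t))
    ((hg'.mul (hw 0)).add ((hg 0).mul hw'))
  simp only [zero_smul, add_zero, mul_zero] at hfirst hsecond
  constructor <;> linarith

/-- A positive solution of `Δu = u³` on `ℝⁿ` satisfies `(u(0) R)² ≤ 8 + 2n` for every `R > 0`. -/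
lemma sq_mul_le_of_lap_eq_cube {n : ℕ} {u : EuclideanSpace ℝ (Fin n) → ℝ} (hu : ContDiff ℝ 2 u)
    (hpos : ∀ x, 0 < u x) (hlap : ∀ x, lap u x = u x ^ 3) {R : ℝ} (hR : 0 < R) :
    (u 0 * R) ^ 2 ≤ 8 + 2 * n := by
  obtain ⟨z, -, hzmax⟩ := (isCompact_closedBall (0 : EuclideanSpace ℝ (Fin n)) R).exists_isMaxOn
    ⟨0, by simp [hR.le]⟩
    (f := fun y => u y * (R ^ 2 - ‖y‖ ^ 2))
    (hu.continuous.mul (by fun_prop)).continuousOn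
  have h0 : u 0 * R ^ 2 ≤ u z * (R ^ 2 - ‖z‖ ^ 2) := by
    simpa using hzmax (show (0 : EuclideanSpace ℝ (Fin n)) ∈ Metric.closedBall 0 R by simp [hR.le])
  have hwpos : 0 < R ^ 2 - ‖z‖ ^ 2 :=
    pos_of_mul_pos_right ((mul_pos (hpos 0) (pow_pos hR 2)).trans_le h0) (hpos z).le
  have hzR : ‖z‖ < R := lt_of_pow_lt_pow_left₀ 2 hR.le (by linarith)
  have hloc := hzmax.isLocalMax (Metric.closedBall_mem_nhds_of_mem (by simpa using hzR))
  set w := R ^ 2 - ‖z‖ ^ 2 with hw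
  have hcond := fun i : Fin n => hloc.directional_conditions hu
    (e := EuclideanSpace.single i (1 : ℝ)) (by simp)
  simp only [EuclideanSpace.inner_single_right, conj_trivial, one_mul] at hcond
  have hterm : ∀ i : Fin n,
      fderiv ℝ (fun y => fderiv ℝ u y (EuclideanSpace.single i 1)) z
        (EuclideanSpace.single i 1) * w ^ 2 ≤ 8 * u z * z i ^ 2 + 2 * u z * w := fun i => by
    obtain ⟨h1, h2⟩ := hcond i
    have h3 := mul_le_mul_of_nonneg_right h2 hwpos.le
    linear_combination h3 + 4 * z i * h1
  have hsum : u z ^ 3 * w ^ 2 ≤ 8 * u z * ‖z‖ ^ 2 + n * (2 * u z * w) := by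
    rw [← hlap z, lap, Finset.sum_mul, EuclideanSpace.real_norm_sq_eq, Finset.mul_sum]
    refine (Finset.sum_le_sum fun i _ => hterm i).trans_eq ?_
    simp [Finset.sum_add_distrib]
  have hdiv : (u z * w) ^ 2 ≤ 8 * ‖z‖ ^ 2 + 2 * n * w := by
    refine le_of_mul_le_mul_left ?_ (hpos z)
    linarith
  have hbound : (u z * w) ^ 2 ≤ (8 + 2 * n) * R ^ 2 := by
    have : (0 : ℝ) ≤ n * ‖z‖ ^ 2 := by positivity
    linarith
  have hsq : (u 0 * R ^ 2) ^ 2 ≤ (u z * w) ^ 2 :=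
    pow_le_pow_left₀ (mul_pos (hpos 0) (pow_pos hR 2)).le h0 2
  refine le_of_mul_le_mul_right ?_ (pow_pos hR 2)
  linarith

/-- Liouville-type theorem (paper's Example 1.2 + Corollary 1.2, Euclidean case):
there is no smooth positive solution of `Δu = u³` on all of `ℝⁿ`. -/
theorem stmt_14 (n : ℕ) (hn : 1 ≤ n) :
    ¬ ∃ u : EuclideanSpace ℝ (Fin n) → ℝ,
      ContDiff ℝ (⊤ : ℕ∞) u ∧ (∀ x, 0 < u x) ∧ (∀ x, lap u x = u x ^ 3) := by
  rintro ⟨u, hu, hpos, hlap⟩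
  have hu2 : ContDiff ℝ 2 u := contDiff_infty.mp hu 2
  have h := sq_mul_le_of_lap_eq_cube hu2 hpos hlap
    (R := (9 + 2 * n) / u 0) (div_pos (by positivity) (hpos 0))
  rw [mul_div_cancel₀ _ (hpos 0).ne'] at h
  have : (0 : ℝ) ≤ n := n.cast_nonneg
  nlinarith
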